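/- Let F_X⁻¹ be absolutely continuous and increasing on [0,1], and let 𝓡 = {R : [0,M]→ℝ : R(0)=0, 0 ≤ R(x)-R(y) ≤ x-y for 0 ≤ y ≤ x ≤ M}. Then the set 𝔾 = {F⁻¹_{R(X)} : R ∈ 𝓡} of quantile functions of R(X) equals {G : [0,1]→ℝ : G absolutely continuous, G(0)=0, 0 ≤ G'(z) ≤ (F_X⁻¹)'(z) for a.e. z ∈ [0,1]}. -/

import Mathlib

open MeasureTheory Set

/-- Left-continuous quantile function of a random variable `Y` under measure `μ`. -/
noncomputable def quantileFn {Ω : Type*} [MeasurableSpace Ω] (μ : Measure Ω)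
    (Y : Ω → ℝ) (t : ℝ) : ℝ :=
  sInf {z : ℝ | 0 ≤ z ∧ t ≤ (μ {ω | Y ω ≤ z}).toReal}

open Filter Topology

/-- A function whose increments are dominated by those of an absolutely continuous function is
absolutely continuous. -/
lemma AbsolutelyContinuousOnInterval.of_dist_le {f g : ℝ → ℝ} {a b : ℝ}
    (hg : AbsolutelyContinuousOnInterval g a b)
    (h : ∀ x ∈ uIcc a b, ∀ y ∈ uIcc a b, dist (f x) (f y) ≤ dist (g x) (g y)) :
    AbsolutelyContinuousOnInterval f a b := by
  rw [absolutelyContinuousOnInterval_iff] at hg ⊢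
  intro ε hε
  obtain ⟨δ, hδ, H⟩ := hg ε hε
  refine ⟨δ, hδ, fun E hE hlt => lt_of_le_of_lt (Finset.sum_le_sum fun i hi => ?_) (H E hE hlt)⟩
  exact h _ (hE.1 i hi).1 _ (hE.1 i hi).2

/-- A monotone function whose increments are dominated by those of a primitive of `φ` is the
primitive of a density lying between `0` and `φ`. -/
lemma exists_density_of_increment_le {φ G : ℝ → ℝ} (hφ : IntervalIntegrable φ volume 0 1)
    (hG0 : G 0 = 0)
    (hG : ∀ x ∈ Icc (0 : ℝ) 1, ∀ y ∈ Icc (0 : ℝ) 1, x ≤ y →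
      0 ≤ G y - G x ∧ G y - G x ≤ (∫ t in (0 : ℝ)..y, φ t) - ∫ t in (0 : ℝ)..x, φ t) :
    ∃ g : ℝ → ℝ, IntegrableOn g (Icc 0 1) ∧
      (∀ᵐ z ∂(volume.restrict (Icc (0 : ℝ) 1)), 0 ≤ g z ∧ g z ≤ φ z) ∧
      ∀ z ∈ Icc (0 : ℝ) 1, G z = ∫ t in (0 : ℝ)..z, g t := by
  set Q : ℝ → ℝ := fun x => ∫ t in (0 : ℝ)..x, φ t
  have hQac : AbsolutelyContinuousOnInterval Q 0 1 :=
    hφ.absolutelyContinuousOnInterval_intervalIntegral (by simp)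
  have hGac : AbsolutelyContinuousOnInterval G 0 1 := by
    refine hQac.of_dist_le fun x hx y hy => ?_
    rw [uIcc_of_le zero_le_one] at hx hy
    rw [Real.dist_eq, Real.dist_eq]
    rcases le_total x y with h | h
    · have := hG x hx y hy h
      rw [abs_sub_comm (G x), abs_sub_comm (Q x), abs_of_nonneg this.1]
      exact this.2.trans (le_abs_self _)
    · have := hG y hy x hx h
      rw [abs_of_nonneg this.1]
      exact this.2.trans (le_abs_self _)
  have hGmono : MonotoneOn G (Icc 0 1) := fun x hx y hy h => sub_nonneg.1 (hG x hx y hy h).1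
  have hDmono : MonotoneOn (fun x => Q x - G x) (Icc 0 1) := fun x hx y hy h => by
    have := (hG x hx y hy h).2
    simp only
    linarith
  refine ⟨deriv G, ?_, ?_, fun z hz => ?_⟩
  · exact (intervalIntegrable_iff_integrableOn_Icc_of_le zero_le_one).1
      hGac.intervalIntegrable_deriv
  · rw [ae_restrict_iff' measurableSet_Icc]
    have h0 : ∀ᵐ x : ℝ, x ≠ 0 := by simp [ae_iff, measure_singleton]
    have h1 : ∀ᵐ x : ℝ, x ≠ 1 := by simp [ae_iff, measure_singleton]
    filter_upwards [h0, h1, hGac.ae_differentiableAt, hφ.ae_hasDerivAt_integral]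
      with x hx0 hx1 hd hi hx
    have hx' : x ∈ uIcc (0 : ℝ) 1 := by rwa [uIcc_of_le zero_le_one]
    have hnhds : Icc (0 : ℝ) 1 ∈ 𝓝 x :=
      Icc_mem_nhds (lt_of_le_of_ne hx.1 hx0.symm) (lt_of_le_of_ne hx.2 hx1)
    have hGd := (hd hx').hasDerivAt
    have hQd : HasDerivAt Q (φ x) x := hi hx' 0 (by simp)
    constructor
    · rw [← derivWithin_of_mem_nhds hnhds]
      exact hGmono.derivWithin_nonneg
    · have h := hDmono.derivWithin_nonneg (x := x)
      rw [derivWithin_of_mem_nhds hnhds, (hQd.fun_sub hGd).deriv] at h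
      linarith
  · have hsub : uIcc 0 z ⊆ uIcc (0 : ℝ) 1 := by
      rw [uIcc_of_le hz.1, uIcc_of_le zero_le_one]
      exact Icc_subset_Icc_right hz.2
    rw [(hGac.mono hsub).integral_deriv_eq_sub, hG0, sub_zero]

/-- If `0 ≤ g ≤ φ` almost everywhere, the increments of the primitive of `g` are nonnegative and
dominated by those of the primitive of `φ`. -/
lemma increment_integral_le {φ g : ℝ → ℝ} (hφ : IntegrableOn φ (Icc 0 1))
    (hg : IntegrableOn g (Icc 0 1))
    (hgφ : ∀ᵐ z ∂(volume.restrict (Icc (0 : ℝ) 1)), 0 ≤ g z ∧ g z ≤ φ z)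
    {x y : ℝ} (hx : 0 ≤ x) (hxy : x ≤ y) (hy : y ≤ 1) :
    0 ≤ (∫ t in (0 : ℝ)..y, g t) - ∫ t in (0 : ℝ)..x, g t ∧
      (∫ t in (0 : ℝ)..y, g t) - ∫ t in (0 : ℝ)..x, g t ≤
        (∫ t in (0 : ℝ)..y, φ t) - ∫ t in (0 : ℝ)..x, φ t := by
  have hii : ∀ f : ℝ → ℝ, IntegrableOn f (Icc 0 1) → ∀ a b : ℝ, 0 ≤ a → a ≤ b → b ≤ 1 →
      IntervalIntegrable f volume a b := fun f hf a b ha hab hb =>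
    (intervalIntegrable_iff_integrableOn_Icc_of_le hab).2 (hf.mono_set (Icc_subset_Icc ha hb))
  have h0y := hx.trans hxy
  have hx1 := hxy.trans hy
  rw [intervalIntegral.integral_interval_sub_left (hii g hg 0 y le_rfl h0y hy)
      (hii g hg 0 x le_rfl hx hx1),
    intervalIntegral.integral_interval_sub_left (hii φ hφ 0 y le_rfl h0y hy)
      (hii φ hφ 0 x le_rfl hx hx1)]
  have hae : ∀ᵐ z ∂(volume.restrict (Icc x y)), 0 ≤ g z ∧ g z ≤ φ z :=
    ae_restrict_of_ae_restrict_of_subset (Icc_subset_Icc hx hy) hgφ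
  exact ⟨intervalIntegral.integral_nonneg_of_ae_restrict hxy (hae.mono fun _ h => h.1),
    intervalIntegral.integral_mono_ae_restrict hxy (hii g hg x y hx hxy hy)
      (hii φ hφ x y hx hxy hy) (hae.mono fun _ h => h.2)⟩

section Quantile

variable {Ω : Type*} [MeasurableSpace Ω] {μ : Measure Ω}

lemma quantileFn_nonneg (Y : Ω → ℝ) (t : ℝ) : 0 ≤ quantileFn μ Y t :=
  Real.sInf_nonneg fun _ hz => hz.1

lemma quantileFn_le {Y : Ω → ℝ} {t z : ℝ} (hz : 0 ≤ z) (ht : t ≤ (μ {ω | Y ω ≤ z}).toReal) :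
    quantileFn μ Y t ≤ z :=
  csInf_le ⟨0, fun _ h => h.1⟩ ⟨hz, ht⟩

lemma quantileFn_zero (Y : Ω → ℝ) : quantileFn μ Y 0 = 0 :=
  le_antisymm (quantileFn_le le_rfl ENNReal.toReal_nonneg) (quantileFn_nonneg Y 0)

variable [IsProbabilityMeasure μ]

lemma toReal_measure_le_mono (Y : Ω → ℝ) :
    Monotone fun z : ℝ => (μ {ω | Y ω ≤ z}).toReal := fun _ _ h =>
  ENNReal.toReal_mono (measure_ne_top _ _) (measure_mono fun _ hω => le_trans hω h)

/-- For `Y` bounded above by `M`, a level `t ≤ 1` is attained by the distribution function at the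
quantile of `t`. -/
lemma le_toReal_measure_le_quantileFn {Y : Ω → ℝ} (hY : Measurable Y) {M : ℝ} (hM : 0 ≤ M)
    (hYM : ∀ ω, Y ω ≤ M) {t : ℝ} (ht : t ≤ 1) :
    t ≤ (μ {ω | Y ω ≤ quantileFn μ Y t}).toReal := by
  have hcdf : ∀ z, (μ {ω | Y ω ≤ z}).toReal = ProbabilityTheory.cdf (μ.map Y) z := fun z => by
    have := Measure.isProbabilityMeasure_map (μ := μ) hY.aemeasurable
    rw [ProbabilityTheory.cdf_eq_real, measureReal_def, Measure.map_apply hY measurableSet_Iic]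
    rfl
  have hne : {z : ℝ | 0 ≤ z ∧ t ≤ (μ {ω | Y ω ≤ z}).toReal}.Nonempty :=
    ⟨M, hM, by simpa [hYM] using ht⟩
  rw [hcdf]
  have hcont := ((ProbabilityTheory.cdf (μ.map Y)).right_continuous (quantileFn μ Y t)).mono
    Ioi_subset_Ici_self
  refine ge_of_tendsto hcont ?_
  filter_upwards [self_mem_nhdsWithin] with w hw
  obtain ⟨s, hs, hsw⟩ := exists_lt_of_csInf_lt hne hw
  exact hs.2.trans ((hcdf s).le.trans (ProbabilityTheory.monotone_cdf _ hsw.le))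

lemma quantileFn_mono {Y : Ω → ℝ} (hY : Measurable Y) {M : ℝ} (hM : 0 ≤ M)
    (hYM : ∀ ω, Y ω ≤ M) {s t : ℝ} (hst : s ≤ t) (ht : t ≤ 1) :
    quantileFn μ Y s ≤ quantileFn μ Y t :=
  quantileFn_le (quantileFn_nonneg Y t)
    (hst.trans (le_toReal_measure_le_quantileFn hY hM hYM ht))

lemma quantileFn_mem_Icc {Y : Ω → ℝ} {M : ℝ} (hM : 0 ≤ M)
    (hYM : ∀ ω, Y ω ≤ M) {t : ℝ} (ht : t ≤ 1) : quantileFn μ Y t ∈ Icc 0 M :=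
  ⟨quantileFn_nonneg Y t, quantileFn_le hM (by simpa [hYM] using ht)⟩

/-- Quantiles commute with nondecreasing continuous transformations fixing `0`. -/
lemma quantileFn_comp {Y : Ω → ℝ} (hY : Measurable Y) {M : ℝ} (hM : 0 ≤ M)
    (hYM : ∀ ω, Y ω ∈ Icc 0 M) {R : ℝ → ℝ} (hR0 : R 0 = 0) (hRmono : MonotoneOn R (Icc 0 M))
    (hRcont : ContinuousOn R (Icc 0 M)) {t : ℝ} (ht : t ≤ 1) :
    quantileFn μ (fun ω => R (Y ω)) t = R (quantileFn μ Y t) := by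
  have hYle : ∀ ω, Y ω ≤ M := fun ω => (hYM ω).2
  have hq : quantileFn μ Y t ∈ Icc 0 M := quantileFn_mem_Icc hM hYle ht
  have hmem : 0 ≤ R (quantileFn μ Y t) ∧
      t ≤ (μ {ω | R (Y ω) ≤ R (quantileFn μ Y t)}).toReal := by
    refine ⟨hR0.symm.le.trans (hRmono ⟨le_rfl, hM⟩ hq hq.1), ?_⟩
    refine (le_toReal_measure_le_quantileFn (μ := μ) hY hM hYle ht).trans ?_
    exact ENNReal.toReal_mono (measure_ne_top _ _)
      (measure_mono fun ω hω => hRmono (hYM ω) hq hω)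
  refine le_antisymm (quantileFn_le (μ := μ) hmem.1 hmem.2) (le_csInf ⟨_, hmem⟩ fun z hz => ?_)
  have hK : IsCompact (Icc 0 M ∩ R ⁻¹' Iic z) :=
    isCompact_Icc.of_isClosed_subset (hRcont.preimage_isClosed_of_isClosed isClosed_Icc isClosed_Iic)
      inter_subset_left
  obtain ⟨x, hx⟩ := hK.exists_isGreatest ⟨0, ⟨le_rfl, hM⟩, by simpa [hR0] using hz.1⟩
  have htx : t ≤ (μ {ω | Y ω ≤ x}).toReal := hz.2.trans <|
    ENNReal.toReal_mono (measure_ne_top _ _) (measure_mono fun ω hω => hx.2 ⟨hYM ω, hω⟩)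
  exact (hRmono hq hx.1.1 (quantileFn_le hx.1.1.1 htx)).trans hx.1.2

/-- The quantile function is a left inverse of a strictly increasing distribution function. -/
lemma quantileFn_toReal_measure_le {Y : Ω → ℝ} (hY : Measurable Y) {M : ℝ} (hM : 0 ≤ M)
    (hYM : ∀ ω, Y ω ≤ M)
    (hstrict : ∀ x ∈ Icc 0 M, ∀ y ∈ Icc 0 M, x < y →
      (μ {ω | Y ω ≤ x}).toReal < (μ {ω | Y ω ≤ y}).toReal) {x : ℝ} (hx : x ∈ Icc 0 M) :
    quantileFn μ Y (μ {ω | Y ω ≤ x}).toReal = x := by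
  have h1 : (μ {ω | Y ω ≤ x}).toReal ≤ 1 := measureReal_le_one
  refine le_antisymm (quantileFn_le hx.1 le_rfl) (le_of_not_gt fun hlt => ?_)
  exact (le_toReal_measure_le_quantileFn hY hM hYM h1).not_gt
    (hstrict _ (quantileFn_mem_Icc hM hYM h1) _ hx hlt)

end Quantile


/-- Lemma 2: the set `𝔾` of quantile functions of `R(X)`, `R`
ranging over the retention class `𝓡`, equals the set of absolutely continuous
functions `G` with `G(0) = 0` and `0 ≤ G' ≤ (F_X⁻¹)'` a.e. on `[0,1]`
(absolute continuity being expressed by an integral representation with an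
integrable density). -/
theorem quantile_set_characterization
    {Ω : Type*} [MeasurableSpace Ω] (μ : Measure Ω) [IsProbabilityMeasure μ]
    (M : ℝ) (hM : 0 < M)
    (X : Ω → ℝ) (hXmeas : Measurable X)
    (hXrange : ∀ ω, X ω ∈ Icc 0 M)
    (hFstrict : ∀ x ∈ Icc 0 M, ∀ y ∈ Icc 0 M, x < y →
      (μ {ω | X ω ≤ x}).toReal < (μ {ω | X ω ≤ y}).toReal)
    -- `F_X⁻¹` is absolutely continuous on `[0,1]` with density `φ`
    (φ : ℝ → ℝ) (hφint : IntegrableOn φ (Icc 0 1))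
    (hφpos : ∀ᵐ z ∂(volume.restrict (Icc (0:ℝ) 1)), 0 ≤ φ z)
    (hrep : ∀ z ∈ Icc (0:ℝ) 1, quantileFn μ X z = ∫ t in (0:ℝ)..z, φ t) :
    {G : ℝ → ℝ | ∃ R : ℝ → ℝ, R 0 = 0 ∧
        (∀ y x : ℝ, 0 ≤ y → y ≤ x → x ≤ M → 0 ≤ R x - R y ∧ R x - R y ≤ x - y) ∧
        ∀ t ∈ Icc (0:ℝ) 1, G t = quantileFn μ (fun ω => R (X ω)) t}
      =
    {G : ℝ → ℝ | G 0 = 0 ∧ ∃ g : ℝ → ℝ, IntegrableOn g (Icc 0 1) ∧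
        (∀ᵐ z ∂(volume.restrict (Icc (0:ℝ) 1)), 0 ≤ g z ∧ g z ≤ φ z) ∧
        ∀ z ∈ Icc (0:ℝ) 1, G z = ∫ t in (0:ℝ)..z, g t} := by
  have hM0 := hM.le
  have hXM : ∀ ω, X ω ≤ M := fun ω => (hXrange ω).2
  have hcomp : ∀ R : ℝ → ℝ, R 0 = 0 →
      (∀ y x : ℝ, 0 ≤ y → y ≤ x → x ≤ M → 0 ≤ R x - R y ∧ R x - R y ≤ x - y) →
      ∀ t : ℝ, t ≤ 1 → quantileFn μ (fun ω => R (X ω)) t = R (quantileFn μ X t) := by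
    intro R hR0 hR t ht
    refine quantileFn_comp hXmeas hM0 hXrange hR0
      (fun y hy x hx h => sub_nonneg.1 (hR y x hy.1 h hx.2).1) ?_ ht
    refine (LipschitzOnWith.of_le_add_mul 1 fun x hx y hy => ?_).continuousOn
    rw [NNReal.coe_one, one_mul, Real.dist_eq]
    rcases le_total x y with h | h
    · linarith [(hR x y hx.1 h hy.2).1, abs_nonneg (x - y)]
    · linarith [(hR y x hy.1 h hx.2).2, le_abs_self (x - y)]
  ext G
  constructor
  · rintro ⟨R, hR0, hR, hG⟩
    have hGR : ∀ t ∈ Icc (0 : ℝ) 1, G t = R (quantileFn μ X t) := fun t ht =>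
      (hG t ht).trans (hcomp R hR0 hR t ht.2)
    have hG0 : G 0 = 0 := by rw [hGR 0 (by simp), quantileFn_zero, hR0]
    refine ⟨hG0, exists_density_of_increment_le
      ((intervalIntegrable_iff_integrableOn_Icc_of_le zero_le_one).2 hφint) hG0
      fun x hx y hy hxy => ?_⟩
    rw [hGR x hx, hGR y hy, ← hrep x hx, ← hrep y hy]
    exact hR _ _ (quantileFn_nonneg X x) (quantileFn_mono hXmeas hM0 hXM hxy hy.2)
      (quantileFn_mem_Icc hM0 hXM hy.2).2
  · rintro ⟨hG0, g, hg, hgφ, hGg⟩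
    have hinc : ∀ x y : ℝ, 0 ≤ x → x ≤ y → y ≤ 1 →
        0 ≤ G y - G x ∧ G y - G x ≤ quantileFn μ X y - quantileFn μ X x := by
      intro x y hx hxy hy
      have hx' : x ∈ Icc (0 : ℝ) 1 := ⟨hx, hxy.trans hy⟩
      have hy' : y ∈ Icc (0 : ℝ) 1 := ⟨hx.trans hxy, hy⟩
      rw [hGg x hx', hGg y hy', hrep x hx', hrep y hy']
      exact increment_integral_le hφint hg hgφ hx hxy hy
    set F : ℝ → ℝ := fun x => (μ {ω | X ω ≤ x}).toReal
    have hF0 : ∀ x, 0 ≤ F x := fun x => ENNReal.toReal_nonneg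
    have hF1 : ∀ x, F x ≤ 1 := fun x => measureReal_le_one
    have hQF : ∀ x ∈ Icc 0 M, quantileFn μ X (F x) = x := fun x hx =>
      quantileFn_toReal_measure_le hXmeas hM0 hXM hFstrict hx
    have hR0 : G (F 0) = 0 := by
      have h := hinc 0 (F 0) le_rfl (hF0 0) (hF1 0)
      rw [hQF 0 ⟨le_rfl, hM0⟩, quantileFn_zero, hG0] at h
      linarith [h.1, h.2]
    have hR : ∀ y x : ℝ, 0 ≤ y → y ≤ x → x ≤ M →
        0 ≤ G (F x) - G (F y) ∧ G (F x) - G (F y) ≤ x - y := by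
      intro y x hy hyx hx
      have h := hinc (F y) (F x) (hF0 y) (toReal_measure_le_mono X hyx) (hF1 x)
      rwa [hQF x ⟨hy.trans hyx, hx⟩, hQF y ⟨hy, hyx.trans hx⟩] at h
    refine ⟨fun x => G (F x), hR0, hR, fun t ht => ?_⟩
    rw [hcomp (fun x => G (F x)) hR0 hR t ht.2]
    have h := hinc t (F (quantileFn μ X t)) ht.1
      (le_toReal_measure_le_quantileFn hXmeas hM0 hXM ht.2) (hF1 _)
    rw [hQF _ (quantileFn_mem_Icc hM0 hXM ht.2), sub_self] at h
    linarith [h.1, h.2]
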